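/- Let K be a field and let L be a finite-dimensional 2-step nilpotent Lie algebra over K with S = [L,L], dim S = t and dim L/S = n. Let n₀, t₀ be positive integers with n₀ ≤ n and t₀ ≤ t. Then L admits a surjective Lie algebra homomorphism onto some finite-dimensional 2-step nilpotent Lie algebra M with dim M/[M,M] = n₀ and dim [M,M] = t₀ if and only if there exists a Lie ideal I of L with dim I = n + t − n₀ − t₀ and dim (I ∩ S) = t − t₀. -/

import Mathlib

/-- A Lie ring is 2-step nilpotent if `⁅L,⁅L,L⁆⁆ = 0` and `⁅L,L⁆ ≠ 0`. -/
def Is2StepNilpotent (L : Type) [LieRing L] : Prop :=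
  (∀ x y z : L, ⁅x, ⁅y, z⁆⁆ = 0) ∧ ¬ (∀ x y : L, ⁅x, y⁆ = 0)

/-- The commutator ideal `[L,L]`, viewed as a submodule of `L`. -/
def commSubmodule (K L : Type) [Field K] [LieRing L] [LieAlgebra K L] : Submodule K L :=
  LieSubmodule.toSubmodule ⁅(⊤ : LieIdeal K L), (⊤ : LieIdeal K L)⁆

/-- `L` belongs to the class `𝔑₂^K(n,t)`: it is 2-step nilpotent with
`dim L/[L,L] = n` and `dim [L,L] = t`. -/
def MemN2 (K L : Type) [Field K] [LieRing L] [LieAlgebra K L] (n t : ℕ) : Prop :=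
  Is2StepNilpotent L ∧
    Module.finrank K (L ⧸ commSubmodule K L) = n ∧
    Module.finrank K (commSubmodule K L) = t

/-- Property `Σ(n₀,t₀)`: `L` admits a surjective Lie algebra homomorphism onto some
finite-dimensional 2-step nilpotent Lie algebra `M` with `dim M/[M,M] = n₀`,
`dim [M,M] = t₀`. -/
def HasSigma (K : Type) [Field K] (L : Type) [LieRing L] [LieAlgebra K L]
    (n₀ t₀ : ℕ) : Prop :=
  ∃ (M : Type) (_ : LieRing M) (_ : LieAlgebra K M) (_ : Module.Finite K M),
    MemN2 K M n₀ t₀ ∧ ∃ f : L →ₗ⁅K⁆ M, Function.Surjective f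

/-- The commutator ideal is the linear span of all brackets. -/
theorem commSubmodule_eq_span (K L : Type) [Field K] [LieRing L] [LieAlgebra K L] :
    commSubmodule K L = Submodule.span K {z : L | ∃ x y : L, ⁅x, y⁆ = z} := by
  rw [commSubmodule, LieSubmodule.lieIdeal_oper_eq_linear_span']
  simp

/-- A surjective Lie algebra homomorphism maps the commutator ideal onto the commutator ideal. -/
theorem map_commSubmodule_of_surjective {K L M : Type} [Field K] [LieRing L] [LieAlgebra K L]
    [LieRing M] [LieAlgebra K M] (f : L →ₗ⁅K⁆ M) (hf : Function.Surjective f) :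
    (commSubmodule K L).map (f : L →ₗ[K] M) = commSubmodule K M := by
  rw [commSubmodule_eq_span, commSubmodule_eq_span, Submodule.map_span]
  congr 1
  ext z
  constructor
  · rintro ⟨_, ⟨x, y, rfl⟩, rfl⟩
    exact ⟨f x, f y, (f.map_lie x y).symm⟩
  · rintro ⟨a, b, rfl⟩
    obtain ⟨x, rfl⟩ := hf a
    obtain ⟨y, rfl⟩ := hf b
    exact ⟨⁅x, y⁆, ⟨x, y, rfl⟩, f.map_lie x y⟩

/-- Rank-nullity for the restriction of a linear map to a submodule. -/
theorem finrank_map_add_finrank_ker_inf {K V W : Type*} [Field K] [AddCommGroup V] [Module K V]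
    [Module.Finite K V] [AddCommGroup W] [Module K W] (f : V →ₗ[K] W) (S : Submodule K V) :
    Module.finrank K (S.map f) + Module.finrank K (LinearMap.ker f ⊓ S : Submodule K V) =
      Module.finrank K S := by
  have h := LinearMap.finrank_range_add_finrank_ker (f.domRestrict S)
  have hker : (LinearMap.ker (f.domRestrict S)).map S.subtype = LinearMap.ker f ⊓ S := by
    ext x
    simp [and_comm]
  rwa [LinearMap.range_domRestrict, ← Submodule.finrank_map_subtype_eq, hker] at h

/-- The quotient map by a Lie ideal, as a Lie algebra homomorphism. -/
def lieQuotientMap {K L : Type} [Field K] [LieRing L] [LieAlgebra K L] (I : LieIdeal K L) :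
    L →ₗ⁅K⁆ L ⧸ I where
  toLinearMap := (LieSubmodule.toSubmodule I).mkQ
  map_lie' := LieSubmodule.Quotient.mk_bracket _ _ _

theorem lieQuotientMap_surjective {K L : Type} [Field K] [LieRing L] [LieAlgebra K L]
    (I : LieIdeal K L) : Function.Surjective (lieQuotientMap I) :=
  (LieSubmodule.toSubmodule I).mkQ_surjective

/-- A quotient of a Lie algebra with `⁅L,⁅L,L⁆⁆ = 0` is 2-step nilpotent as soon as its
commutator ideal is nonzero. -/
theorem is2StepNilpotent_of_surjective {K L M : Type} [Field K] [LieRing L] [LieAlgebra K L]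
    [LieRing M] [LieAlgebra K M] (f : L →ₗ⁅K⁆ M) (hf : Function.Surjective f)
    (hL : ∀ x y z : L, ⁅x, ⁅y, z⁆⁆ = 0) (hM : commSubmodule K M ≠ ⊥) :
    Is2StepNilpotent M := by
  refine ⟨fun a b c => ?_, fun h => hM ?_⟩
  · obtain ⟨x, rfl⟩ := hf a
    obtain ⟨y, rfl⟩ := hf b
    obtain ⟨z, rfl⟩ := hf c
    rw [← f.map_lie, ← f.map_lie, hL, map_zero]
  · rw [commSubmodule_eq_span, Submodule.span_eq_bot]
    rintro _ ⟨x, y, rfl⟩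
    exact h x y


/-- A finite-dimensional 2-step nilpotent Lie algebra L with S = [L,L],
dim S = t, dim L/S = n has property Σ(n₀,t₀) (n₀ ≤ n, t₀ ≤ t) iff there exists a Lie
ideal I with dim I = n + t − n₀ − t₀ and dim (I ∩ S) = t − t₀. -/
theorem hasSigma_iff_exists_ideal
    (K L : Type) [Field K] [LieRing L] [LieAlgebra K L] [Module.Finite K L]
    (n t n₀ t₀ : ℕ) (hn₀ : 0 < n₀) (ht₀ : 0 < t₀) (hn : n₀ ≤ n) (ht : t₀ ≤ t)
    (h2step : Is2StepNilpotent L)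
    (hdim1 : Module.finrank K (L ⧸ commSubmodule K L) = n)
    (hdim2 : Module.finrank K (commSubmodule K L) = t) :
    HasSigma K L n₀ t₀ ↔
      ∃ I : LieIdeal K L,
        Module.finrank K (LieSubmodule.toSubmodule I) = n + t - n₀ - t₀ ∧
        Module.finrank K
          (LieSubmodule.toSubmodule I ⊓ commSubmodule K L : Submodule K L) = t - t₀ := by
  have hL := (commSubmodule K L).finrank_quotient_add_finrank
  constructor
  · rintro ⟨M, _, _, _, ⟨_, hM₁, hM₂⟩, f, hf⟩
    have hM := (commSubmodule K M).finrank_quotient_add_finrank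
    have hS := finrank_map_add_finrank_ker_inf (f : L →ₗ[K] M) (commSubmodule K L)
    have hT := LinearMap.finrank_range_add_finrank_ker (f : L →ₗ[K] M)
    rw [map_commSubmodule_of_surjective f hf] at hS
    rw [LinearMap.range_eq_top.mpr hf, finrank_top] at hT
    refine ⟨f.ker, ?_, ?_⟩
    · rw [LieHom.ker_toSubmodule]
      omega
    · rw [LieHom.ker_toSubmodule]
      omega
  · rintro ⟨I, hI, hIS⟩
    have hf := lieQuotientMap_surjective I
    have hM := (commSubmodule K (L ⧸ I)).finrank_quotient_add_finrank
    have hS := finrank_map_add_finrank_ker_inf (lieQuotientMap I : L →ₗ[K] L ⧸ I)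
      (commSubmodule K L)
    have hker : LinearMap.ker (lieQuotientMap I : L →ₗ[K] L ⧸ I) = LieSubmodule.toSubmodule I :=
      Submodule.ker_mkQ _
    have hT : Module.finrank K (L ⧸ I) + Module.finrank K (LieSubmodule.toSubmodule I) =
        Module.finrank K L := (LieSubmodule.toSubmodule I).finrank_quotient_add_finrank
    rw [map_commSubmodule_of_surjective _ hf, hker] at hS
    have hfin : Module.Finite K (L ⧸ I) :=
      Module.Finite.of_surjective (lieQuotientMap I : L →ₗ[K] L ⧸ I) hf
    refine ⟨L ⧸ I, inferInstance, inferInstance, hfin,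
      ⟨is2StepNilpotent_of_surjective (K := K) _ hf h2step.1 fun h => ?_, ?_, ?_⟩, _, hf⟩
    · rw [h, finrank_bot] at hS
      omega
    · omega
    · omega
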